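/- arXiv:1602.07456 — 2 statements merged into one kernel-verified Lean document; each statement's English description precedes it below -/
import Mathlib

section
/- For every scalar α₋ ∈ K, the assignment ∂₋(x₊) = ∂₋(z₊) = 0, ∂₋(x₋) = α₋·c(z)·z₊, ∂₋(z₋) = α₋·x₊ on generators extends to a (right) skew σ₋-derivation ∂₋ of the generalized Weyl algebra A(p;q), i.e. a K-linear map ∂₋: A(p;q) → A(p;q) satisfying ∂₋(ab) = ∂₋(a)σ₋(b) + a∂₋(b) for all a, b ∈ A(p;q). -/
noncomputable section

open Polynomial
open scoped Classical

namespace GWAPaper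

variable (K : Type) [Field K]

/-- Defining relations of the generalized Weyl algebra `A(p;q)`; the generators are
indexed by `Fin 4` with `0 ↦ x₊`, `1 ↦ x₋`, `2 ↦ z₊`, `3 ↦ z₋`. -/
inductive GWARel (q : K) (p : K[X]) :
    FreeAlgebra K (Fin 4) → FreeAlgebra K (Fin 4) → Prop
  | zz : GWARel q p (FreeAlgebra.ι K (2 : Fin 4) * FreeAlgebra.ι K (3 : Fin 4))
      (FreeAlgebra.ι K (3 : Fin 4) * FreeAlgebra.ι K (2 : Fin 4))
  | xpzp : GWARel q p (FreeAlgebra.ι K (0 : Fin 4) * FreeAlgebra.ι K (2 : Fin 4))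
      (q⁻¹ • (FreeAlgebra.ι K (2 : Fin 4) * FreeAlgebra.ι K (0 : Fin 4)))
  | xpzm : GWARel q p (FreeAlgebra.ι K (0 : Fin 4) * FreeAlgebra.ι K (3 : Fin 4))
      (q⁻¹ • (FreeAlgebra.ι K (3 : Fin 4) * FreeAlgebra.ι K (0 : Fin 4)))
  | xmzp : GWARel q p (FreeAlgebra.ι K (1 : Fin 4) * FreeAlgebra.ι K (2 : Fin 4))
      (q • (FreeAlgebra.ι K (2 : Fin 4) * FreeAlgebra.ι K (1 : Fin 4)))
  | xmzm : GWARel q p (FreeAlgebra.ι K (1 : Fin 4) * FreeAlgebra.ι K (3 : Fin 4))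
      (q • (FreeAlgebra.ι K (3 : Fin 4) * FreeAlgebra.ι K (1 : Fin 4)))
  | xpxm : GWARel q p (FreeAlgebra.ι K (0 : Fin 4) * FreeAlgebra.ι K (1 : Fin 4))
      (Polynomial.aeval (FreeAlgebra.ι K (2 : Fin 4) * FreeAlgebra.ι K (3 : Fin 4)) p)
  | xmxp : GWARel q p (FreeAlgebra.ι K (1 : Fin 4) * FreeAlgebra.ι K (0 : Fin 4))
      (Polynomial.aeval ((q ^ 2 : K) • (FreeAlgebra.ι K (3 : Fin 4) * FreeAlgebra.ι K (2 : Fin 4))) p)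

/-- The generalized Weyl algebra `A(p;q)`. -/
abbrev GWA (q : K) (p : K[X]) : Type := RingQuot (GWARel K q p)

/-- The images of the four generators in `A(p;q)`. -/
def gwaGen (q : K) (p : K[X]) (i : Fin 4) : GWA K q p :=
  RingQuot.mkAlgHom K (GWARel K q p) (FreeAlgebra.ι K i)

/-- The generator `x₊`. -/
def xp (q : K) (p : K[X]) : GWA K q p := gwaGen K q p 0
/-- The generator `x₋`. -/
def xm (q : K) (p : K[X]) : GWA K q p := gwaGen K q p 1
/-- The generator `z₊`. -/
def zp (q : K) (p : K[X]) : GWA K q p := gwaGen K q p 2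
/-- The generator `z₋`. -/
def zm (q : K) (p : K[X]) : GWA K q p := gwaGen K q p 3

/-- ℤ-degrees of the generators: `deg x₊ = deg z₊ = 1`, `deg x₋ = deg z₋ = -1`. -/
def gwaWt : Fin 4 → ℤ := ![1, -1, 1, -1]

/-- The total degree of a word in the generators. -/
def wordDeg (w : List (Fin 4)) : ℤ := (w.map gwaWt).sum

/-- The product in `A(p;q)` of the letters of a word. -/
def wordVal (q : K) (p : K[X]) (w : List (Fin 4)) : GWA K q p :=
  (w.map (gwaGen K q p)).prod

/-- The degree-`n` homogeneous component of the ℤ-graded algebra `A(p;q)`: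
the `K`-linear span of the values of all words of total degree `n`. -/
def component (q : K) (p : K[X]) (n : ℤ) : Submodule K (GWA K q p) :=
  Submodule.span K {a | ∃ w : List (Fin 4), wordDeg w = n ∧ wordVal K q p w = a}

/-- The `q²`-derivative `p_{q²}` of a polynomial `p`, equal to
`(p(q²z) - p(z))/((q²-1)z)` if `q² ≠ 1` and to `p'` if `q² = 1`. -/
def qDeriv (q : K) (p : K[X]) : K[X] :=
  if q ^ 2 = 1 then derivative p
  else (p.comp (C (q ^ 2) * X) - p) / (C (q ^ 2 - 1) * X)

/-- The polynomial `c(z) = q·p_{q²}(z)`. -/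
def cPoly (q : K) (p : K[X]) : K[X] := C q * qDeriv K q p

/-- `p` is `q²`-separable: `p(z)` is coprime with `z·p_{q²}(z)`. -/
def QSeparable (q : K) (p : K[X]) : Prop := IsCoprime p (X * qDeriv K q p)


theorem X_mul_qDeriv (q : K) (p : K[X]) :
    C (q ^ 2 - 1) * X * qDeriv K q p = p.comp (C (q ^ 2) * X) - p := by
  unfold qDeriv
  split_ifs with h
  · simp [h]
  · have h' : q ^ 2 - 1 ≠ 0 := sub_ne_zero.mpr h
    refine EuclideanDomain.mul_div_cancel' (mul_ne_zero (C_ne_zero.mpr h') X_ne_zero) ?_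
    rw [(isUnit_C.mpr h'.isUnit).mul_left_dvd, X_dvd_iff, coeff_zero_eq_eval_zero]
    simp [eval_comp]

theorem eq_qDeriv {q : K} (hq : q ^ 2 ≠ 1) {p f : K[X]}
    (h : C (q ^ 2 - 1) * X * f = p.comp (C (q ^ 2) * X) - p) : f = qDeriv K q p := by
  rw [← X_mul_qDeriv] at h
  exact mul_left_cancel₀ (mul_ne_zero (C_ne_zero.mpr (sub_ne_zero.mpr hq)) X_ne_zero) h

theorem qDeriv_C (q a : K) : qDeriv K q (C a) = 0 := by
  by_cases h : q ^ 2 = 1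
  · simp [qDeriv, h]
  · exact (eq_qDeriv K h (by simp)).symm

theorem qDeriv_add (q : K) (f g : K[X]) :
    qDeriv K q (f + g) = qDeriv K q f + qDeriv K q g := by
  by_cases h : q ^ 2 = 1
  · simp [qDeriv, h]
  · refine (eq_qDeriv K h ?_).symm
    rw [mul_add, X_mul_qDeriv, X_mul_qDeriv, add_comp]
    ring

theorem qDeriv_X_mul (q : K) (f : K[X]) :
    qDeriv K q (X * f) = f + C (q ^ 2) * X * qDeriv K q f := by
  by_cases h : q ^ 2 = 1
  · simp [qDeriv, h]
  · refine (eq_qDeriv K h ?_).symm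
    rw [mul_add, mul_left_comm, X_mul_qDeriv, mul_comp, X_comp, C_sub, C_1]
    ring

variable {K} {A : Type*} [Ring A] [Algebra K A]

theorem mul_aeval_of_mul_eq {x y z : A} (h : x * y = z * x) (f : K[X]) :
    x * aeval y f = aeval z f * x := by
  induction f using Polynomial.induction_on' with
  | add f g hf hg => rw [map_add, map_add, mul_add, add_mul, hf, hg]
  | monomial n a =>
    rw [aeval_monomial, aeval_monomial, ← mul_assoc, ← Algebra.commutes, mul_assoc, mul_assoc,
      (show SemiconjBy x y z from h).pow_right n]

theorem aeval_smul_eq_add_qDeriv (q : K) (z : A) (f : K[X]) :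
    aeval (q ^ 2 • z) f = aeval z f + (q ^ 2 - 1) • (z * aeval z (qDeriv K q f)) := by
  have h := congrArg (aeval z) (X_mul_qDeriv K q f)
  rw [map_sub (aeval (R := K) z), aeval_comp, mul_assoc, map_mul, map_mul, map_mul, aeval_C,
    aeval_C, aeval_X, ← Algebra.smul_def, ← Algebra.smul_def] at h
  rw [h, add_sub_cancel]

/-- Evaluating a polynomial at a `2 × 2` upper triangular matrix whose off-diagonal entry
`q²`-commutes with the diagonal one produces the `q²`-derivative off the diagonal. -/
theorem aeval_upperTriangular (q : K) {z d : A} (h : z * d = q ^ 2 • (d * z)) (f : K[X]) :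
    aeval (!![z, d; 0, z] : Matrix (Fin 2) (Fin 2) A) f =
      !![aeval z f, d * aeval z (qDeriv K q f); 0, aeval z f] := by
  have hC (f : K[X]) : aeval z (C (q ^ 2) * X * f) = q ^ 2 • (z * aeval z f) := by
    rw [mul_assoc, map_mul, map_mul, aeval_C, aeval_X, ← Algebra.smul_def]
  induction f using Polynomial.induction_on with
  | C a =>
    rw [aeval_C, aeval_C, qDeriv_C, map_zero, mul_zero, Matrix.algebraMap_eq_diagonal]
    ext i j
    fin_cases i <;> fin_cases j <;> simp
  | add f g hf hg =>
    rw [map_add, hf, hg, qDeriv_add]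
    ext i j
    fin_cases i <;> fin_cases j <;> simp [mul_add]
  | monomial n a ih =>
    rw [pow_succ', mul_left_comm, map_mul, ih, aeval_X, qDeriv_X_mul]
    generalize C a * X ^ n = f
    ext i j
    fin_cases i <;> fin_cases j <;>
      simp [Matrix.mul_apply, mul_add, ← mul_assoc, h, hC, add_comm, -map_mul, -map_pow,
        map_mul (aeval z) X]

section Relations

variable {q : K} {p : K[X]}

theorem zp_mul_zm : zp K q p * zm K q p = zm K q p * zp K q p := by
  simpa [gwaGen, zp, zm] using RingQuot.mkAlgHom_rel K (GWARel.zz (q := q) (p := p))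

theorem xp_mul_zp : xp K q p * zp K q p = q⁻¹ • (zp K q p * xp K q p) := by
  simpa [gwaGen, zp, xp] using RingQuot.mkAlgHom_rel K (GWARel.xpzp (q := q) (p := p))

theorem xp_mul_zm : xp K q p * zm K q p = q⁻¹ • (zm K q p * xp K q p) := by
  simpa [gwaGen, zm, xp] using RingQuot.mkAlgHom_rel K (GWARel.xpzm (q := q) (p := p))

theorem xm_mul_zp : xm K q p * zp K q p = q • (zp K q p * xm K q p) := by
  simpa [gwaGen, zp, xm] using RingQuot.mkAlgHom_rel K (GWARel.xmzp (q := q) (p := p))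

theorem xm_mul_zm : xm K q p * zm K q p = q • (zm K q p * xm K q p) := by
  simpa [gwaGen, zm, xm] using RingQuot.mkAlgHom_rel K (GWARel.xmzm (q := q) (p := p))

theorem xp_mul_xm : xp K q p * xm K q p = aeval (zp K q p * zm K q p) p := by
  simpa [gwaGen, zm, zp, xp, xm, ← aeval_algHom_apply] using
    RingQuot.mkAlgHom_rel K (GWARel.xpxm (q := q) (p := p))

theorem xm_mul_xp : xm K q p * xp K q p = aeval (q ^ 2 • (zp K q p * zm K q p)) p := by
  rw [zp_mul_zm]
  simpa [gwaGen, zm, zp, xp, xm, ← aeval_algHom_apply] using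
    RingQuot.mkAlgHom_rel K (GWARel.xmxp (q := q) (p := p))

end Relations

/-- The upper triangular matrices `!![a, ∂₋ a; 0, σ₋ a]` for the generators `a` of `A(p;q)`. -/
def dminusGen (q : K) (p : K[X]) (αm : K) : Fin 4 → Matrix (Fin 2) (Fin 2) (GWA K q p) :=
  ![!![xp K q p, 0; 0, q • xp K q p],
    !![xm K q p, αm • (aeval (zp K q p * zm K q p) (cPoly K q p) * zp K q p);
      0, q⁻¹ • xm K q p],
    !![zp K q p, 0; 0, q • zp K q p],
    !![zm K q p, αm • xp K q p; 0, q⁻¹ • zm K q p]]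

theorem lift_dminusGen_rel {q : K} (hq : q ≠ 0) (p : K[X]) (αm : K)
    {x y : FreeAlgebra K (Fin 4)} (h : GWARel K q p x y) :
    FreeAlgebra.lift K (dminusGen q p αm) x = FreeAlgebra.lift K (dminusGen q p αm) y := by
  have hzx : zp K q p * xp K q p = q • (xp K q p * zp K q p) := by
    rw [xp_mul_zp, smul_inv_smul₀ hq]
  have hzx' : zm K q p * xp K q p = q • (xp K q p * zm K q p) := by
    rw [xp_mul_zm, smul_inv_smul₀ hq]
  have hz (f : K[X]) : zp K q p * aeval (zp K q p * zm K q p) f =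
      aeval (zp K q p * zm K q p) f * zp K q p :=
    mul_aeval_of_mul_eq (by rw [mul_assoc, zp_mul_zm]) f
  have hz' (f : K[X]) : zm K q p * aeval (zp K q p * zm K q p) f =
      aeval (zp K q p * zm K q p) f * zm K q p :=
    mul_aeval_of_mul_eq (by rw [← mul_assoc, zp_mul_zm]) f
  have hx (f : K[X]) : xp K q p * aeval (q ^ 2 • (zp K q p * zm K q p)) f =
      aeval (zp K q p * zm K q p) f * xp K q p := by
    refine mul_aeval_of_mul_eq ?_ f
    rw [mul_assoc, hzx', mul_smul_comm, mul_smul_comm, ← mul_assoc, ← mul_assoc, hzx,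
      smul_mul_assoc, smul_smul, pow_two]
  have hc : aeval (zp K q p * zm K q p) (cPoly K q p) =
      q • aeval (zp K q p * zm K q p) (qDeriv K q p) := by
    rw [cPoly, map_mul, aeval_C, ← Algebra.smul_def]
  have hd : zp K q p * zm K q p * (αm • (zp K q p * xp K q p)) =
      q ^ 2 • (αm • (zp K q p * xp K q p) * (zp K q p * zm K q p)) := by
    rw [mul_smul_comm, smul_mul_assoc, smul_comm]
    congr 1
    calc _ = zp K q p * (zm K q p * zp K q p) * xp K q p := by simp only [mul_assoc]
      _ = zp K q p * zp K q p * (zm K q p * xp K q p) := by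
        simp only [← zp_mul_zm, mul_assoc]
      _ = q • (zp K q p * (zp K q p * xp K q p) * zm K q p) := by
        simp only [hzx', mul_assoc, mul_smul_comm]
      _ = _ := by
        have hzzx : zp K q p * (zp K q p * xp K q p) = q • (zp K q p * xp K q p * zp K q p) := by
          conv_lhs => rw [hzx]
          rw [mul_smul_comm, mul_assoc]
        rw [hzzx, smul_mul_assoc, smul_smul, pow_two, mul_assoc]
  have hM : dminusGen q p αm 2 * dminusGen q p αm 3 =
      !![zp K q p * zm K q p, αm • (zp K q p * xp K q p); 0, zp K q p * zm K q p] := by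
    ext i j
    fin_cases i <;> fin_cases j <;> simp [dminusGen, Matrix.mul_apply, smul_smul, hq]
  have hM' : dminusGen q p αm 3 * dminusGen q p αm 2 =
      dminusGen q p αm 2 * dminusGen q p αm 3 := by
    rw [hM]
    ext i j
    fin_cases i <;> fin_cases j <;>
      simp [dminusGen, Matrix.mul_apply, smul_smul, hq, zp_mul_zm, hzx, mul_comm]
  cases h with
  | zz => simpa using hM'.symm
  | xpzp =>
    simp only [map_mul, map_smul, FreeAlgebra.lift_ι_apply]
    ext i j
    fin_cases i <;> fin_cases j <;>
      simp [dminusGen, Matrix.mul_apply, smul_smul, hq, hzx]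
  | xpzm =>
    simp only [map_mul, map_smul, FreeAlgebra.lift_ι_apply]
    ext i j
    fin_cases i <;> fin_cases j <;>
      simp [dminusGen, Matrix.mul_apply, smul_smul, hq, hzx', mul_comm αm]
  | xmzp =>
    simp only [map_mul, map_smul, FreeAlgebra.lift_ι_apply]
    ext i j
    fin_cases i <;> fin_cases j <;>
      simp [dminusGen, Matrix.mul_apply, smul_smul, hq, xm_mul_zp, hz, ← mul_assoc]
  | xmzm =>
    simp only [map_mul, map_smul, FreeAlgebra.lift_ι_apply]
    ext i j
    fin_cases i <;> fin_cases j <;>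
      simp [dminusGen, Matrix.mul_apply, smul_smul, hq, xm_mul_zm]
    rw [← mul_assoc (zm K q p), hz', xm_mul_xp, xp_mul_xm, aeval_smul_eq_add_qDeriv,
      mul_aeval_of_mul_eq rfl, mul_assoc _ (zm K q p), ← zp_mul_zm, mul_assoc _ (zp K q p), hc,
      smul_mul_assoc]
    match_scalars <;> field_simp
    ring
  | xpxm =>
    rw [← aeval_algHom_apply]
    simp only [map_mul, FreeAlgebra.lift_ι_apply]
    rw [hM, aeval_upperTriangular q hd]
    ext i j
    fin_cases i <;> fin_cases j <;>
      simp [dminusGen, Matrix.mul_apply, smul_smul, hq, xp_mul_xm]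
    rw [hzx, hc, smul_mul_assoc, smul_mul_assoc, mul_smul_comm, mul_assoc, hz]
  | xmxp =>
    rw [← aeval_algHom_apply]
    simp only [map_mul, map_smul, FreeAlgebra.lift_ι_apply]
    have hsmul : q ^ 2 • (dminusGen q p αm 3 * dminusGen q p αm 2) =
        !![q ^ 2 • (zp K q p * zm K q p), q ^ 2 • αm • (zp K q p * xp K q p);
          0, q ^ 2 • (zp K q p * zm K q p)] := by
      rw [hM', hM]
      ext i j
      fin_cases i <;> fin_cases j <;> simp
    rw [hsmul, aeval_upperTriangular q
      (by rw [smul_mul_smul_comm, smul_mul_smul_comm, hd, smul_comm])]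
    ext i j
    fin_cases i <;> fin_cases j <;>
      simp [dminusGen, Matrix.mul_apply, smul_smul, hq, xm_mul_xp]
    rw [mul_assoc (zp K q p), hx, hc, ← mul_assoc, hz]
    simp only [smul_mul_assoc, smul_smul, mul_assoc]
    congr 1
    ring

variable (K)

/-- For every `α₋ ∈ K` the given assignment on generators extends to a
right skew `σ₋`-derivation `∂₋` of `A(p;q)`. -/
theorem skew_derivation_dminus_exists [CharZero K]
    (q : K) (hq : q ≠ 0) (p : K[X])
    (αm : K)
    (σm : GWA K q p ≃ₐ[K] GWA K q p)
    (hσm : ∀ (n : ℤ) (a : GWA K q p), a ∈ component K q p n → σm a = q ^ n • a)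
    :
    ∃ Dm : GWA K q p →ₗ[K] GWA K q p,
      Dm (xp K q p) = 0 ∧
      Dm (zp K q p) = 0 ∧
      Dm (xm K q p) = αm • (aeval (zp K q p * zm K q p) (cPoly K q p) * zp K q p) ∧
      Dm (zm K q p) = αm • xp K q p ∧
      ∀ a b : GWA K q p, Dm (a * b) = Dm a * σm b + a * Dm b := by
  have hwt (i : Fin 4) : σm (gwaGen K q p i) = q ^ gwaWt i • gwaGen K q p i :=
    hσm _ _ (Submodule.subset_span ⟨[i], by simp [wordDeg], by simp [wordVal]⟩)
  let φ : GWA K q p →ₐ[K] Matrix (Fin 2) (Fin 2) (GWA K q p) :=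
    RingQuot.liftAlgHom K ⟨FreeAlgebra.lift K (dminusGen q p αm),
      fun _ _ h => lift_dminusGen_rel hq p αm h⟩
  have hφ (i : Fin 4) : φ (gwaGen K q p i) = dminusGen q p αm i := by
    simp [φ, gwaGen]
  have key (a : GWA K q p) : φ a 0 0 = a ∧ φ a 1 0 = 0 ∧ φ a 1 1 = σm a := by
    obtain ⟨a, rfl⟩ := RingQuot.mkAlgHom_surjective K (GWARel K q p) a
    induction a using FreeAlgebra.induction with
    | grade0 r => simp [Matrix.algebraMap_matrix_apply]
    | grade1 i =>
      rw [← gwaGen, hφ, hwt]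
      fin_cases i <;> simp [dminusGen, gwaWt, xp, xm, zp, zm]
    | mul a b ha hb => simp [Matrix.mul_apply, ha, hb]
    | add a b ha hb => simp [ha, hb]
  refine ⟨Matrix.entryLinearMap K (GWA K q p) 0 1 ∘ₗ φ.toLinearMap, ?_, ?_, ?_, ?_, fun a b => ?_⟩
  · simp [xp, hφ, dminusGen]
  · simp [zp, hφ, dminusGen]
  · simp [xm, hφ, dminusGen]
  · simp [zm, hφ, dminusGen]
  · simpa [Matrix.mul_apply, key] using add_comm _ _

end GWAPaper
end
end

section
/- The maps δ₊ := ∂₊ ∘ Θ and δ₋ := ∂₋ ∘ Θ from B(p;q) to A(p;q) take values in the homogeneous components A(p;q)₋₂ and A(p;q)₂ respectively, and are derivations along Θ, i.e. δ_±(uv) = δ_±(u)Θ(v) + Θ(u)δ_±(v) for all u, v ∈ B(p;q). Moreover, ∂₀ ∘ Θ = 0. -/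
noncomputable section

open Polynomial
open scoped Classical

namespace GWAPaper

variable (K : Type) [Field K]

/-- Defining relations of the algebra `B(p;q)`; the generators are indexed by `Fin 3`
with `0 ↦ x`, `1 ↦ y`, `2 ↦ z`. -/
inductive GWBRel (q : K) (p : K[X]) : FreeAlgebra K (Fin 3) → FreeAlgebra K (Fin 3) → Prop
  | xz : GWBRel q p (FreeAlgebra.ι K (0 : Fin 3) * FreeAlgebra.ι K (2 : Fin 3))
      ((q ^ 2) • (FreeAlgebra.ι K (2 : Fin 3) * FreeAlgebra.ι K (0 : Fin 3)))
  | yz : GWBRel q p (FreeAlgebra.ι K (1 : Fin 3) * FreeAlgebra.ι K (2 : Fin 3))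
      ((q ^ 2)⁻¹ • (FreeAlgebra.ι K (2 : Fin 3) * FreeAlgebra.ι K (1 : Fin 3)))
  | xy : GWBRel q p (FreeAlgebra.ι K (0 : Fin 3) * FreeAlgebra.ι K (1 : Fin 3))
      ((q ^ 2) • (FreeAlgebra.ι K (2 : Fin 3) *
        Polynomial.aeval ((q ^ 2 : K) • FreeAlgebra.ι K (2 : Fin 3)) p))
  | yx : GWBRel q p (FreeAlgebra.ι K (1 : Fin 3) * FreeAlgebra.ι K (0 : Fin 3))
      (FreeAlgebra.ι K (2 : Fin 3) * Polynomial.aeval (FreeAlgebra.ι K (2 : Fin 3)) p)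

/-- The generalized Weyl algebra `B(p;q)`. -/
abbrev GWB (q : K) (p : K[X]) : Type := RingQuot (GWBRel K q p)

/-- The generator `x` of `B(p;q)`. -/
def bX (q : K) (p : K[X]) : GWB K q p := RingQuot.mkAlgHom K (GWBRel K q p) (FreeAlgebra.ι K 0)
/-- The generator `y` of `B(p;q)`. -/
def bY (q : K) (p : K[X]) : GWB K q p := RingQuot.mkAlgHom K (GWBRel K q p) (FreeAlgebra.ι K 1)
/-- The generator `z` of `B(p;q)`. -/
def bZ (q : K) (p : K[X]) : GWB K q p := RingQuot.mkAlgHom K (GWBRel K q p) (FreeAlgebra.ι K 2)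

section

variable {K}

theorem wordVal_mem_component (q : K) (p : K[X]) (w : List (Fin 4)) :
    wordVal K q p w ∈ component K q p (wordDeg w) :=
  Submodule.subset_span ⟨w, rfl, rfl⟩

theorem gwaGen_mem_component (q : K) (p : K[X]) (i : Fin 4) :
    gwaGen K q p i ∈ component K q p (gwaWt i) := by
  simpa [wordVal, wordDeg] using wordVal_mem_component q p [i]

theorem xp_mem_component (q : K) (p : K[X]) : xp K q p ∈ component K q p 1 :=
  gwaGen_mem_component q p 0

theorem xm_mem_component (q : K) (p : K[X]) : xm K q p ∈ component K q p (-1) :=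
  gwaGen_mem_component q p 1

theorem zp_mem_component (q : K) (p : K[X]) : zp K q p ∈ component K q p 1 :=
  gwaGen_mem_component q p 2

theorem zm_mem_component (q : K) (p : K[X]) : zm K q p ∈ component K q p (-1) :=
  gwaGen_mem_component q p 3

instance component_gradedMonoid (q : K) (p : K[X]) :
    SetLike.GradedMonoid (component K q p) where
  one_mem := by simpa [wordVal, wordDeg] using wordVal_mem_component q p []
  mul_mem {m n a b} ha hb := by
    have h := Submodule.mul_mem_mul ha hb
    rw [component, component, Submodule.span_mul_span] at h
    refine Submodule.span_mono ?_ h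
    rintro _ ⟨_, ⟨v, rfl, rfl⟩, _, ⟨w, rfl, rfl⟩, rfl⟩
    exact ⟨v ++ w, by simp [wordDeg], by simp [wordVal]⟩

theorem mul_mem_component {q : K} {p : K[X]} {m n k : ℤ} (h : m + n = k) {a b : GWA K q p}
    (ha : a ∈ component K q p m) (hb : b ∈ component K q p n) :
    a * b ∈ component K q p k :=
  h ▸ SetLike.mul_mem_graded ha hb

theorem aeval_mem_component_zero {q : K} {p : K[X]} {a : GWA K q p}
    (ha : a ∈ component K q p 0) (f : K[X]) : aeval a f ∈ component K q p 0 :=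
  Algebra.adjoin_le (S := SetLike.GradeZero.subalgebra (component K q p))
    (Set.singleton_subset_iff.2 ha) (aeval_mem_adjoin_singleton K a)

/-- A subalgebra of `B(p;q)` containing the generators `x`, `y`, `z` is everything. -/
theorem gwb_mem_of_gens {q : K} {p : K[X]} (S : Subalgebra K (GWB K q p))
    (hx : bX K q p ∈ S) (hy : bY K q p ∈ S) (hz : bZ K q p ∈ S) (u : GWB K q p) : u ∈ S := by
  obtain ⟨a, rfl⟩ := RingQuot.mkAlgHom_surjective K (GWBRel K q p) u
  induction a using FreeAlgebra.induction with
  | grade0 r => simpa only [AlgHom.commutes] using S.algebraMap_mem r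
  | grade1 i => fin_cases i <;> assumption
  | mul a b ha hb => simpa only [map_mul] using S.mul_mem ha hb
  | add a b ha hb => simpa only [map_add] using S.add_mem ha hb

theorem skewDerivation_algebraMap {A : Type*} [Ring A] [Algebra K A] {D : A →ₗ[K] A}
    {σ : A ≃ₐ[K] A} (hD : ∀ a b, D (a * b) = D a * σ b + a * D b) (r : K) :
    D (algebraMap K A r) = 0 := by
  have h : D 1 = 0 := by simpa using hD 1 1
  rw [Algebra.algebraMap_eq_smul_one, map_smul, h, smul_zero]

/-- If `Θ` takes values in the fixed points of `σ`, then a skew `σ`-derivation becomes an ordinary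
derivation along `Θ`, so its values on `B(p;q)` lie in any sub-bimodule over the image of `Θ` that
contains its values on the generators. -/
theorem skewDerivation_comp_mem {A : Type*} [Ring A] [Algebra K A] {q : K} {p : K[X]}
    {D : A →ₗ[K] A} {σ : A ≃ₐ[K] A} (hD : ∀ a b, D (a * b) = D a * σ b + a * D b)
    {Θ : GWB K q p →ₐ[K] A} (hσ : ∀ u, σ (Θ u) = Θ u) {M : Submodule K A}
    (hMr : ∀ a ∈ M, ∀ u, a * Θ u ∈ M) (hMl : ∀ a ∈ M, ∀ u, Θ u * a ∈ M)
    (hx : D (Θ (bX K q p)) ∈ M) (hy : D (Θ (bY K q p)) ∈ M) (hz : D (Θ (bZ K q p)) ∈ M)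
    (u : GWB K q p) : D (Θ u) ∈ M := by
  let S : Subalgebra K (GWB K q p) :=
    { carrier := {u | D (Θ u) ∈ M}
      mul_mem' := fun {a b} ha hb => by
        simp only [Set.mem_ofPred_eq, map_mul, hD, hσ] at *
        exact M.add_mem (hMr _ ha _) (hMl _ hb _)
      add_mem' := fun {a b} ha hb => by
        simp only [Set.mem_ofPred_eq, map_add] at *
        exact M.add_mem ha hb
      algebraMap_mem' := fun r => by
        simp only [Set.mem_ofPred_eq, AlgHom.commutes, skewDerivation_algebraMap hD, M.zero_mem] }
  exact gwb_mem_of_gens S hx hy hz u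

end

/-- The maps `δ₊ = ∂₊∘Θ` and `δ₋ = ∂₋∘Θ` take values in `A(p;q)₋₂` and
`A(p;q)₂` respectively and are derivations along `Θ`; moreover `∂₀∘Θ = 0`. -/
theorem delta_derivations [CharZero K]
    (q : K) (hq : q ≠ 0) (p : K[X])
    (α0 αm αp : K)
    (σm : GWA K q p ≃ₐ[K] GWA K q p)
    (hσm : ∀ (n : ℤ) (a : GWA K q p), a ∈ component K q p n → σm a = q ^ n • a)
    (σ0 : GWA K q p ≃ₐ[K] GWA K q p)
    (hσ0 : ∀ (n : ℤ) (a : GWA K q p), a ∈ component K q p n → σ0 a = q ^ (2 * n) • a)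
    (D0 Dm Dp : GWA K q p →ₗ[K] GWA K q p)
    (hD0leib : ∀ a b, D0 (a * b) = D0 a * σ0 b + a * D0 b)
    (hD0xp : D0 (xp K q p) = α0 • xp K q p)
    (hD0xm : D0 (xm K q p) = -(q ^ (-2 : ℤ) * α0) • xm K q p)
    (hD0zp : D0 (zp K q p) = α0 • zp K q p)
    (hD0zm : D0 (zm K q p) = -(q ^ (-2 : ℤ) * α0) • zm K q p)
    (hDmleib : ∀ a b, Dm (a * b) = Dm a * σm b + a * Dm b)
    (hDmxp : Dm (xp K q p) = 0)
    (hDmzp : Dm (zp K q p) = 0)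
    (hDmxm : Dm (xm K q p) = αm • (aeval (zp K q p * zm K q p) (cPoly K q p) * zp K q p))
    (hDmzm : Dm (zm K q p) = αm • xp K q p)
    (hDpleib : ∀ a b, Dp (a * b) = Dp a * σm b + a * Dp b)
    (hDpxm : Dp (xm K q p) = 0)
    (hDpzm : Dp (zm K q p) = 0)
    (hDpxp : Dp (xp K q p) = αp • (aeval (zp K q p * zm K q p) (cPoly K q p) * zm K q p))
    (hDpzp : Dp (zp K q p) = αp • xm K q p)
    (Θ : GWB K q p →ₐ[K] GWA K q p)
    (hΘx : Θ (bX K q p) = xm K q p * zp K q p)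
    (hΘy : Θ (bY K q p) = zm K q p * xp K q p)
    (hΘz : Θ (bZ K q p) = zm K q p * zp K q p) :
    (∀ u : GWB K q p, Dp (Θ u) ∈ component K q p (-2)) ∧
    (∀ u : GWB K q p, Dm (Θ u) ∈ component K q p 2) ∧
    (∀ u v : GWB K q p, Dp (Θ (u * v)) = Dp (Θ u) * Θ v + Θ u * Dp (Θ v)) ∧
    (∀ u v : GWB K q p, Dm (Θ (u * v)) = Dm (Θ u) * Θ v + Θ u * Dm (Θ v)) ∧
    (∀ u : GWB K q p, D0 (Θ u) = 0) := by
  have hzz : zp K q p * zm K q p ∈ component K q p 0 :=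
    mul_mem_component (by norm_num) (zp_mem_component q p) (zm_mem_component q p)
  have hc := aeval_mem_component_zero hzz (cPoly K q p)
  have hΘ : ∀ u, Θ u ∈ component K q p 0 := by
    refine gwb_mem_of_gens ((SetLike.GradeZero.subalgebra (component K q p)).comap Θ) ?_ ?_ ?_
    · change Θ _ ∈ component K q p 0
      rw [hΘx]
      exact mul_mem_component (by norm_num) (xm_mem_component q p) (zp_mem_component q p)
    · change Θ _ ∈ component K q p 0
      rw [hΘy]
      exact mul_mem_component (by norm_num) (zm_mem_component q p) (xp_mem_component q p)
    · change Θ _ ∈ component K q p 0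
      rw [hΘz]
      exact mul_mem_component (by norm_num) (zm_mem_component q p) (zp_mem_component q p)
  have hσmΘ : ∀ u, σm (Θ u) = Θ u := fun u => by simpa using hσm 0 _ (hΘ u)
  have hσ0Θ : ∀ u, σ0 (Θ u) = Θ u := fun u => by simpa using hσ0 0 _ (hΘ u)
  have hσmxp : σm (xp K q p) = q • xp K q p := by simpa using hσm 1 _ (xp_mem_component q p)
  have hσmzp : σm (zp K q p) = q • zp K q p := by simpa using hσm 1 _ (zp_mem_component q p)
  have hσ0xp : σ0 (xp K q p) = q ^ (2 : ℤ) • xp K q p := by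
    simpa using hσ0 1 _ (xp_mem_component q p)
  have hσ0zp : σ0 (zp K q p) = q ^ (2 : ℤ) • zp K q p := by
    simpa using hσ0 1 _ (zp_mem_component q p)
  have hq2 : q ^ (-2 : ℤ) * α0 * q ^ (2 : ℤ) = α0 := by
    rw [mul_right_comm, ← zpow_add₀ hq]; simp
  have hMr : ∀ n, ∀ a ∈ component K q p n, ∀ u, a * Θ u ∈ component K q p n :=
    fun n a ha u => mul_mem_component (add_zero n) ha (hΘ u)
  have hMl : ∀ n, ∀ a ∈ component K q p n, ∀ u, Θ u * a ∈ component K q p n :=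
    fun n a ha u => mul_mem_component (zero_add n) (hΘ u) ha
  refine ⟨skewDerivation_comp_mem hDpleib hσmΘ (hMr _) (hMl _) ?_ ?_ ?_,
    skewDerivation_comp_mem hDmleib hσmΘ (hMr _) (hMl _) ?_ ?_ ?_,
    fun u v => by rw [map_mul, hDpleib, hσmΘ], fun u v => by rw [map_mul, hDmleib, hσmΘ],
    fun u => (Submodule.mem_bot K).1 <|
      skewDerivation_comp_mem hD0leib hσ0Θ (by simp) (by simp) ?_ ?_ ?_ u⟩
  · rw [hΘx, hDpleib, hDpxm, hDpzp, zero_mul, zero_add, mul_smul_comm]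
    exact Submodule.smul_mem _ _ <|
      mul_mem_component (by norm_num) (xm_mem_component q p) (xm_mem_component q p)
  · rw [hΘy, hDpleib, hDpzm, hDpxp, zero_mul, zero_add, mul_smul_comm]
    exact Submodule.smul_mem _ _ <| mul_mem_component (by norm_num) (zm_mem_component q p) <|
      mul_mem_component (zero_add _) hc (zm_mem_component q p)
  · rw [hΘz, hDpleib, hDpzm, hDpzp, zero_mul, zero_add, mul_smul_comm]
    exact Submodule.smul_mem _ _ <|
      mul_mem_component (by norm_num) (zm_mem_component q p) (xm_mem_component q p)
  · rw [hΘx, hDmleib, hDmxm, hDmzp, mul_zero, add_zero, hσmzp, smul_mul_smul_comm]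
    exact Submodule.smul_mem _ _ <| mul_mem_component (by norm_num)
      (mul_mem_component (zero_add _) hc (zp_mem_component q p)) (zp_mem_component q p)
  · rw [hΘy, hDmleib, hDmzm, hDmxp, mul_zero, add_zero, hσmxp, smul_mul_smul_comm]
    exact Submodule.smul_mem _ _ <|
      mul_mem_component (by norm_num) (xp_mem_component q p) (xp_mem_component q p)
  · rw [hΘz, hDmleib, hDmzm, hDmzp, mul_zero, add_zero, hσmzp, smul_mul_smul_comm]
    exact Submodule.smul_mem _ _ <|
      mul_mem_component (by norm_num) (xp_mem_component q p) (zp_mem_component q p)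
  · rw [Submodule.mem_bot, hΘx, hD0leib, hD0xm, hD0zp, hσ0zp, smul_mul_smul_comm, neg_mul, hq2,
      mul_smul_comm, ← add_smul, neg_add_cancel, zero_smul]
  · rw [Submodule.mem_bot, hΘy, hD0leib, hD0zm, hD0xp, hσ0xp, smul_mul_smul_comm, neg_mul, hq2,
      mul_smul_comm, ← add_smul, neg_add_cancel, zero_smul]
  · rw [Submodule.mem_bot, hΘz, hD0leib, hD0zm, hD0zp, hσ0zp, smul_mul_smul_comm, neg_mul, hq2,
      mul_smul_comm, ← add_smul, neg_add_cancel, zero_smul]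

end GWAPaper
end
end
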